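/- (Identity axioms hold in S3) In the Lewis system S3, strict equivalence satisfies the axioms of propositional identity: for all modal formulas φ, ψ, φ', ψ', the formulas (φ≡ψ)→(¬φ≡¬ψ), ((φ≡ψ)∧(φ'≡ψ'))→((φ→φ')≡(ψ→ψ')), and (φ≡ψ)→(□φ≡□ψ) are theorems of S3. -/

import Mathlib

/-- Modal formulas over countably many propositional variables x₀, x₁, …. -/
inductive Fm : Type
  | var : ℕ → Fm
  | neg : Fm → Fm
  | imp : Fm → Fm → Fm
  | box : Fm → Fm
deriving DecidableEq

namespace Fm

/-- ⊤ := x₀ → x₀ -/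
def top : Fm := imp (var 0) (var 0)

/-- φ ∧ ψ := ¬(φ → ¬ψ) -/
def conj (φ ψ : Fm) : Fm := neg (imp φ (neg ψ))

/-- φ ↔ ψ := (φ → ψ) ∧ (ψ → φ) -/
def biimp (φ ψ : Fm) : Fm := conj (imp φ ψ) (imp ψ φ)

/-- strict equivalence: φ ≡ ψ := □(φ → ψ) ∧ □(ψ → φ) -/
def equiv (φ ψ : Fm) : Fm := conj (box (imp φ ψ)) (box (imp ψ φ))

/-- φ[x := ψ]: substitution of ψ for all occurrences of the variable x in φ. -/
def subst (φ : Fm) (x : ℕ) (ψ : Fm) : Fm :=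
  match φ with
  | var y => if y = x then ψ else var y
  | neg χ => neg (subst χ x ψ)
  | imp χ δ => imp (subst χ x ψ) (subst δ x ψ)
  | box χ => box (subst χ x ψ)

/-- Propositional (two-valued) evaluation of a modal formula, treating
variables and boxed formulas as atoms. -/
def pEval (v : Fm → Bool) : Fm → Bool
  | var n => v (var n)
  | neg φ => !(pEval v φ)
  | imp φ ψ => !(pEval v φ) || pEval v ψ
  | box φ => v (box φ)

/-- φ has the form of a propositional tautology, i.e. φ is a substitution
instance of a propositional tautology. -/
def isTautInstance (φ : Fm) : Prop := ∀ v : Fm → Bool, pEval v φ = true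

/-- The axioms (i)–(iii) of Lewis system S1 (Lemmon-style). -/
inductive S1Axiom : Fm → Prop
  | taut {φ} : isTautInstance φ → S1Axiom φ
  | ax2 (φ) : S1Axiom (imp (box φ) φ)
  | ax3 (φ ψ χ) :
      S1Axiom (imp (conj (box (imp φ ψ)) (box (imp ψ χ))) (box (imp φ χ)))

/-- The identity axioms (iv)–(vi), i.e. the Substitution Principle SP. -/
inductive SPAxiom : Fm → Prop
  | ax4 (φ ψ) : SPAxiom (imp (equiv φ ψ) (equiv (neg φ) (neg ψ)))
  | ax5 (φ ψ φ' ψ') :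
      SPAxiom (imp (conj (equiv φ ψ) (equiv φ' ψ'))
        (equiv (imp φ φ') (imp ψ ψ')))
  | ax6 (φ ψ) : SPAxiom (imp (equiv φ ψ) (equiv (box φ) (box ψ)))

/-- Derivability in S1+SP from a set Φ of premises: axioms (i)–(vi),
modus ponens, and Axiom Necessitation AN restricted to axioms (i)–(iii). -/
inductive S1SP : Set Fm → Fm → Prop
  | prem {Φ φ} : φ ∈ Φ → S1SP Φ φ
  | axm {Φ φ} : S1Axiom φ → S1SP Φ φ
  | spAxm {Φ φ} : SPAxiom φ → S1SP Φ φ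
  | mp {Φ φ ψ} : S1SP Φ (imp φ ψ) → S1SP Φ φ → S1SP Φ ψ
  | an {Φ φ} : S1Axiom φ → S1SP Φ (box φ)

end Fm

namespace Fm

/-- The axioms of Lewis system S3: the S1 axioms (i)–(iii) together with
the scheme (3) □(φ→ψ) → □(□φ→□ψ). -/
inductive S3Axiom : Fm → Prop
  | s1 {φ} : S1Axiom φ → S3Axiom φ
  | ax3 (φ ψ) : S3Axiom (imp (box (imp φ ψ)) (box (imp (box φ) (box ψ))))

/-- Derivability in Lewis system S3 from a set Φ of premises: axioms
(i)–(iii),(3), modus ponens, Axiom Necessitation AN applicable to all axioms,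
and Substitution of Proved Strict Equivalents SPSE. -/
inductive S3 : Set Fm → Fm → Prop
  | prem {Φ φ} : φ ∈ Φ → S3 Φ φ
  | axm {Φ φ} : S3Axiom φ → S3 Φ φ
  | mp {Φ φ ψ} : S3 Φ (imp φ ψ) → S3 Φ φ → S3 Φ ψ
  | an {Φ φ} : S3Axiom φ → S3 Φ (box φ)
  | spse {Φ} (φ : Fm) (x : ℕ) {ψ ψ'} : S3 ∅ (equiv ψ ψ') →
      S3 Φ (equiv (subst φ x ψ) (subst φ x ψ'))

end Fm

namespace Fm

theorem boxMono {a b : Fm} (h : isTautInstance (imp a b)) : S3 ∅ (imp (box a) (box b)) :=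
  S3.mp (S3.axm (S3Axiom.s1 (S1Axiom.ax2 _)))
    (S3.mp (S3.axm (S3Axiom.ax3 a b)) (S3.an (S3Axiom.s1 (S1Axiom.taut h))))

theorem tautS3 {a : Fm} (h : isTautInstance a) : S3 ∅ a :=
  S3.axm (S3Axiom.s1 (S1Axiom.taut h))

theorem conjMono {a b c d : Fm}
    (h1 : S3 ∅ (imp a c)) (h2 : S3 ∅ (imp b d)) : S3 ∅ (imp (conj a b) (conj c d)) := by
  refine S3.mp (S3.mp (tautS3 ?_) h1) h2
  intro v
  simp only [conj, pEval]
  cases pEval v a <;> cases pEval v b <;> cases pEval v c <;> cases pEval v d <;> rfl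

theorem conjSwap {a b c d : Fm}
    (h1 : S3 ∅ (imp a c)) (h2 : S3 ∅ (imp b d)) : S3 ∅ (imp (conj a b) (conj d c)) := by
  refine S3.mp (S3.mp (tautS3 ?_) h1) h2
  intro v
  simp only [conj, pEval]
  cases pEval v a <;> cases pEval v b <;> cases pEval v c <;> cases pEval v d <;> rfl

theorem impStep (p q p' q' : Fm) :
    S3 ∅ (imp (box (imp q p)) (imp (box (imp p' q')) (box (imp (imp p p') (imp q q'))))) := by
  have h1 : S3 ∅ (imp (box (imp q p)) (box (imp (imp p p') (imp q p')))) := by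
    apply boxMono
    intro v
    simp only [pEval]
    cases pEval v p <;> cases pEval v q <;> cases pEval v p' <;> rfl
  have h2 : S3 ∅ (imp (box (imp p' q')) (box (imp (imp q p') (imp q q')))) := by
    apply boxMono
    intro v
    simp only [pEval]
    cases pEval v q' <;> cases pEval v q <;> cases pEval v p' <;> rfl
  have h3 := S3.axm (Φ := ∅) (S3Axiom.s1 (S1Axiom.ax3 (imp p p') (imp q p') (imp q q')))
  refine S3.mp (S3.mp (S3.mp (tautS3 ?_) h1) h2) h3
  generalize imp (imp p p') (imp q p') = A
  generalize imp (imp q p') (imp q q') = B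
  generalize imp (imp p p') (imp q q') = C
  generalize imp q p = D
  generalize imp p' q' = E
  intro v
  simp only [conj, pEval]
  cases v (box A) <;> cases v (box B) <;> cases v (box C) <;> cases v (box D) <;>
    cases v (box E) <;> rfl

end Fm

open Fm in
/-- In S3, strict equivalence satisfies the identity axioms (c)–(e). -/
theorem identity_axioms_in_S3 (φ ψ φ' ψ' : Fm) :
    S3 ∅ (imp (equiv φ ψ) (equiv (neg φ) (neg ψ))) ∧
    S3 ∅ (imp (conj (equiv φ ψ) (equiv φ' ψ'))
      (equiv (imp φ φ') (imp ψ ψ'))) ∧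
    S3 ∅ (imp (equiv φ ψ) (equiv (box φ) (box ψ))) := by
  refine ⟨?_, ?_, ?_⟩
  · apply conjSwap
    · apply boxMono
      intro v
      simp only [pEval]
      cases pEval v φ <;> cases pEval v ψ <;> rfl
    · apply boxMono
      intro v
      simp only [pEval]
      cases pEval v φ <;> cases pEval v ψ <;> rfl
  · have h1 := impStep φ ψ φ' ψ'
    have h2 := impStep ψ φ ψ' φ'
    refine S3.mp (S3.mp (tautS3 ?_) h1) h2
    unfold equiv
    generalize imp (imp φ φ') (imp ψ ψ') = A
    generalize imp (imp ψ ψ') (imp φ φ') = B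
    generalize imp φ ψ = C
    generalize imp ψ φ = D
    generalize imp φ' ψ' = E
    generalize imp ψ' φ' = F
    intro v
    simp only [conj, pEval]
    cases v (box A) <;> cases v (box B) <;> cases v (box C) <;> cases v (box D) <;>
      cases v (box E) <;> cases v (box F) <;> rfl
  · exact conjMono (S3.axm (S3Axiom.ax3 _ _)) (S3.axm (S3Axiom.ax3 _ _))
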